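/- arXiv:1410.8766 — 3 statements merged into one kernel-verified Lean document; each statement's English description precedes it below -/
import Mathlib

section
/- Assume the linear model X_a = X^aθ⁰_a + ε_a with S₀ = {j : θ⁰_{a,j} ≠ 0}. On the event Λ_a = { max_{j≠a} (2/n)|ε_aᵀX^a_j| ≤ λ₀ + Bμ₀ }, if λ ≥ 2λ₀ and μ ≥ 2μ₀, then the neighborhood-fused lasso estimate θ̂^{λ,μ}_a satisfies (2/n)‖X^a(θ̂^{λ,μ}_a − θ⁰_a)‖² + (λ − 3Bμ)‖θ̂^{λ,μ}_{a,S₀^c}‖₁ ≤ (3λ + 5Bμ)‖θ̂^{λ,μ}_{a,S₀} − θ⁰_{a,S₀}‖₁. -/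
open Finset Matrix

/-- (Oracle-type inequality on the event `Λ_a`.)
Assume the linear model `X_a = X^aθ⁰ + ε` with active set `S₀ = {j : θ⁰_j ≠ 0}`.
On the event `Λ_a = {max_j (2/n)|εᵀX^a_j| ≤ λ₀ + Bμ₀}`, if `λ ≥ 2λ₀` and `μ ≥ 2μ₀`,
then the neighborhood-fused lasso estimate `θ̂` satisfies
`(2/n)‖X^a(θ̂−θ⁰)‖² + (λ−3Bμ)‖θ̂_{S₀ᶜ}‖₁ ≤ (3λ+5Bμ)‖θ̂_{S₀} − θ⁰_{S₀}‖₁`. -/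
theorem nfl_oracle_inequality_on_event
    {n q m : ℕ}
    (Xa : Fin n → ℝ)                         -- response (the `a`-th variable)
    (Xd : Matrix (Fin n) (Fin q) ℝ)          -- design matrix `X^a`
    (θ0 : Fin q → ℝ) (eps : Fin n → ℝ)
    (hmodel : Xa = Xd.mulVec θ0 + eps)       -- linear truth
    (S0 : Finset (Fin q)) (hS0 : ∀ j, j ∈ S0 ↔ θ0 j ≠ 0)
    (D : Matrix (Fin m) (Fin q) ℝ)
    -- rows of the difference matrix `D^a` have the form `e_i − e_j`
    (hD : ∀ r : Fin m, ∃ i j : Fin q, i ≠ j ∧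
      D r = fun s => (if s = i then (1 : ℝ) else 0) - (if s = j then 1 else 0))
    (B : ℝ)
    -- `B` bounds the maximal column `ℓ₁`-norm of `D^a` (number of local neighbors)
    (hB : ∀ b : Fin q, (∑ r, |D r b|) ≤ B)
    (lam0 mu0 lam mu : ℝ) (hlam0 : 0 < lam0) (hmu0 : 0 < mu0)
    (hlam : lam ≥ 2 * lam0) (hmu : mu ≥ 2 * mu0)
    -- the event `Λ_a`
    (hΛ : ∀ j : Fin q, (2 / (n : ℝ)) * |∑ i, eps i * Xd i j| ≤ lam0 + B * mu0)
    (θhat : Fin q → ℝ)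
    (hθhat : ∀ θ : Fin q → ℝ,
      (1 / (n : ℝ)) * (∑ i, (Xa i - Xd.mulVec θhat i) ^ 2)
          + lam * ∑ j, |θhat j| + mu * ∑ r, |D.mulVec θhat r| ≤
      (1 / (n : ℝ)) * (∑ i, (Xa i - Xd.mulVec θ i) ^ 2)
          + lam * ∑ j, |θ j| + mu * ∑ r, |D.mulVec θ r|) :
    (2 / (n : ℝ)) * (∑ i, (Xd.mulVec (θhat - θ0) i) ^ 2)
        + (lam - 3 * B * mu) * ∑ j ∈ S0ᶜ, |θhat j| ≤
    (3 * lam + 5 * B * mu) * ∑ j ∈ S0, |θhat j - θ0 j| := by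
  have hB0 : ∀ b : Fin q, 0 ≤ B := fun b =>
    le_trans (Finset.sum_nonneg (fun r _ => abs_nonneg _)) (hB b)
  have hlamp : 0 < lam := by linarith
  have hmup : 0 < mu := by linarith
  set δ : Fin q → ℝ := θhat - θ0 with hδ
  -- split of the l1 norm of the error
  have hsplit : ∑ j, |δ j| = ∑ j ∈ S0, |θhat j - θ0 j| + ∑ j ∈ S0ᶜ, |θhat j| := by
    rw [← Finset.sum_add_sum_compl S0]
    congr 1
    apply Finset.sum_congr rfl
    intro j hj
    have h0 : θ0 j = 0 := by
      by_contra h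
      exact (Finset.mem_compl.mp hj) ((hS0 j).mpr h)
    simp [hδ, h0]
  have hl1 : ∑ j, |θ0 j| - ∑ j, |θhat j| ≤
      ∑ j ∈ S0, |θhat j - θ0 j| - ∑ j ∈ S0ᶜ, |θhat j| := by
    rw [← Finset.sum_add_sum_compl S0 (fun j => |θ0 j|),
      ← Finset.sum_add_sum_compl S0 (fun j => |θhat j|)]
    have h1 : ∑ j ∈ S0ᶜ, |θ0 j| = 0 := by
      apply Finset.sum_eq_zero
      intro j hj
      have h0 : θ0 j = 0 := by
        by_contra h
        exact (Finset.mem_compl.mp hj) ((hS0 j).mpr h)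
      simp [h0]
    have h2 : ∑ j ∈ S0, |θ0 j| ≤ ∑ j ∈ S0, |θhat j - θ0 j| + ∑ j ∈ S0, |θhat j| := by
      rw [← Finset.sum_add_distrib]
      apply Finset.sum_le_sum
      intro j _
      have h3 := abs_sub_abs_le_abs_sub (θ0 j) (θhat j)
      rw [abs_sub_comm] at h3
      linarith
    linarith
  have hDδ : ∑ r, |D.mulVec δ r| ≤ B * ∑ j, |δ j| := by
    calc ∑ r, |D.mulVec δ r| ≤ ∑ r, ∑ j, |D r j| * |δ j| := by
          apply Finset.sum_le_sum
          intro r _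
          simp only [Matrix.mulVec, dotProduct]
          refine (Finset.abs_sum_le_sum_abs _ _).trans (le_of_eq ?_)
          simp only [abs_mul]
      _ = ∑ j, (∑ r, |D r j|) * |δ j| := by
          rw [Finset.sum_comm]
          simp only [Finset.sum_mul]
      _ ≤ ∑ j, B * |δ j| := by
          apply Finset.sum_le_sum
          intro j _
          exact mul_le_mul_of_nonneg_right (hB j) (abs_nonneg _)
      _ = B * ∑ j, |δ j| := by rw [Finset.mul_sum]
  have hfuse : ∑ r, |D.mulVec θ0 r| - ∑ r, |D.mulVec θhat r| ≤ ∑ r, |D.mulVec δ r| := by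
    rw [← Finset.sum_sub_distrib]
    apply Finset.sum_le_sum
    intro r _
    rw [hδ, Matrix.mulVec_sub, Pi.sub_apply, abs_sub_comm]
    exact abs_sub_abs_le_abs_sub _ _
  have hnoise : (2 / (n : ℝ)) * ∑ i, eps i * Xd.mulVec δ i ≤
      (lam / 2 + B * mu / 2) * ∑ j, |δ j| := by
    have h1 : ∑ i, eps i * Xd.mulVec δ i = ∑ j, (∑ i, eps i * Xd i j) * δ j := by
      simp only [Matrix.mulVec, dotProduct, Finset.mul_sum, Finset.sum_mul]
      rw [Finset.sum_comm]
      simp only [mul_assoc]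
    rw [h1, Finset.mul_sum, Finset.mul_sum]
    apply Finset.sum_le_sum
    intro j _
    have h2 : lam0 + B * mu0 ≤ lam / 2 + B * mu / 2 := by
      nlinarith [mul_nonneg (hB0 j) (by linarith : 0 ≤ mu - 2 * mu0)]
    have hn : (0 : ℝ) ≤ 2 / (n : ℝ) := by positivity
    calc 2 / (n : ℝ) * ((∑ i, eps i * Xd i j) * δ j)
        ≤ 2 / (n : ℝ) * (|∑ i, eps i * Xd i j| * |δ j|) := by
          apply mul_le_mul_of_nonneg_left _ hn
          rw [← abs_mul]
          exact le_abs_self _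
      _ = (2 / (n : ℝ) * |∑ i, eps i * Xd i j|) * |δ j| := by ring
      _ ≤ _ := mul_le_mul_of_nonneg_right ((hΛ j).trans h2) (abs_nonneg _)
  have hBa : 0 ≤ B * mu * ∑ j ∈ S0, |θhat j - θ0 j| := by
    rw [Finset.mul_sum]
    apply Finset.sum_nonneg
    intro j _
    exact mul_nonneg (mul_nonneg (hB0 j) hmup.le) (abs_nonneg _)
  have hbasic := hθhat θ0
  have hs0 : ∑ i, (Xa i - Xd.mulVec θ0 i) ^ 2 = ∑ i, eps i ^ 2 := by
    simp [hmodel]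
  have hs1 : ∑ i, (Xa i - Xd.mulVec θhat i) ^ 2 =
      ∑ i, eps i ^ 2 - 2 * ∑ i, eps i * Xd.mulVec δ i + ∑ i, (Xd.mulVec δ i) ^ 2 := by
    rw [Finset.mul_sum, ← Finset.sum_sub_distrib, ← Finset.sum_add_distrib]
    apply Finset.sum_congr rfl
    intro i _
    rw [hδ, hmodel, Matrix.mulVec_sub]
    simp only [Pi.add_apply, Pi.sub_apply]
    ring
  rw [hs0, hs1] at hbasic
  have hlam1 := mul_le_mul_of_nonneg_left hl1 hlamp.le
  have hmu1 := mul_le_mul_of_nonneg_left (hfuse.trans hDδ) hmup.le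
  rw [hsplit] at hnoise hmu1
  have e1 : (2 / (n : ℝ)) = 2 * (1 / (n : ℝ)) := by ring
  rw [e1] at hnoise ⊢
  linarith
end

section
/- Assume the linear model X_a = X^aθ⁰_a + ε_a with S₀ = {j : θ⁰_{a,j} ≠ 0}. On the event Λ_a = { max_{j≠a} (2/n)|ε_aᵀX^a_j| ≤ λ₀ + Bμ₀ }, if λ ≥ 2λ₀, μ ≥ 2μ₀ and λ ≥ (3 + 14/Δ)Bμ for some Δ > 0, then the neighborhood-fused lasso estimate θ̂^{λ,μ}_a lies in the cone: ‖θ̂^{λ,μ}_{a,S₀^c}‖₁ ≤ (3 + Δ)‖θ̂^{λ,μ}_{a,S₀} − θ⁰_{a,S₀}‖₁. -/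
open Finset Matrix

/-- (Cone condition for the neighborhood-fused lasso.)
Assume the linear model `X_a = X^aθ⁰ + ε` with active set `S₀ = {j : θ⁰_j ≠ 0}`.
On the event `Λ_a`, if `λ ≥ 2λ₀`, `μ ≥ 2μ₀` and `λ ≥ (3 + 14/Δ)Bμ` for some `Δ > 0`,
then `‖θ̂_{S₀ᶜ}‖₁ ≤ (3 + Δ)‖θ̂_{S₀} − θ⁰_{S₀}‖₁`. -/
theorem nfl_cone_condition
    {n q m : ℕ}
    (Xa : Fin n → ℝ)                         -- response (the `a`-th variable)
    (Xd : Matrix (Fin n) (Fin q) ℝ)          -- design matrix `X^a`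
    (θ0 : Fin q → ℝ) (eps : Fin n → ℝ)
    (hmodel : Xa = Xd.mulVec θ0 + eps)       -- linear truth
    (S0 : Finset (Fin q)) (hS0 : ∀ j, j ∈ S0 ↔ θ0 j ≠ 0)
    (D : Matrix (Fin m) (Fin q) ℝ)
    -- rows of the difference matrix `D^a` have the form `e_i − e_j`
    (hD : ∀ r : Fin m, ∃ i j : Fin q, i ≠ j ∧
      D r = fun s => (if s = i then (1 : ℝ) else 0) - (if s = j then 1 else 0))
    (B : ℝ)
    -- `B` bounds the maximal column `ℓ₁`-norm of `D^a` (number of local neighbors)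
    (hB : ∀ b : Fin q, (∑ r, |D r b|) ≤ B)
    (lam0 mu0 lam mu : ℝ) (hlam0 : 0 < lam0) (hmu0 : 0 < mu0)
    (hlam : lam ≥ 2 * lam0) (hmu : mu ≥ 2 * mu0)
    (Δ : ℝ) (hΔ : 0 < Δ) (hlamMu : lam ≥ (3 + 14 / Δ) * (B * mu))
    -- the event `Λ_a`
    (hΛ : ∀ j : Fin q, (2 / (n : ℝ)) * |∑ i, eps i * Xd i j| ≤ lam0 + B * mu0)
    (θhat : Fin q → ℝ)
    (hθhat : ∀ θ : Fin q → ℝ,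
      (1 / (n : ℝ)) * (∑ i, (Xa i - Xd.mulVec θhat i) ^ 2)
          + lam * ∑ j, |θhat j| + mu * ∑ r, |D.mulVec θhat r| ≤
      (1 / (n : ℝ)) * (∑ i, (Xa i - Xd.mulVec θ i) ^ 2)
          + lam * ∑ j, |θ j| + mu * ∑ r, |D.mulVec θ r|) :
    (∑ j ∈ S0ᶜ, |θhat j|) ≤ (3 + Δ) * ∑ j ∈ S0, |θhat j - θ0 j| := by
  rcases Nat.eq_zero_or_pos q with hq | hq
  · subst hq
    rw [Finset.sum_eq_zero fun j _ => j.elim0, Finset.sum_eq_zero fun j _ => j.elim0, mul_zero]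
  have hB0 : 0 ≤ B := le_trans (Finset.sum_nonneg fun r _ => abs_nonneg _) (hB ⟨0, hq⟩)
  have hmupos : 0 < mu := by linarith
  have hlampos : 0 < lam := by linarith
  have hN : 0 ≤ 1 / (n : ℝ) := by positivity
  have hmin := hθhat θ0
  set T : ℝ := ∑ j, |θhat j - θ0 j| with hT
  have hT0 : 0 ≤ T := Finset.sum_nonneg fun r _ => abs_nonneg _
  -- the fused penalty
  have hDd : ∑ r, |D.mulVec θ0 r| ≤ ∑ r, |D.mulVec θhat r| + B * T := by
    have h1 : ∀ r, |D.mulVec θ0 r| ≤ |D.mulVec θhat r| + ∑ s, |D r s| * |θhat s - θ0 s| := by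
      intro r
      have e : D.mulVec θ0 r = D.mulVec θhat r - ∑ s, D r s * (θhat s - θ0 s) := by
        simp only [Matrix.mulVec, dotProduct, ← Finset.sum_sub_distrib]
        exact Finset.sum_congr rfl fun s _ => by ring
      rw [e]
      refine (abs_sub _ _).trans ?_
      gcongr
      refine (Finset.abs_sum_le_sum_abs _ _).trans (le_of_eq ?_)
      exact Finset.sum_congr rfl fun s _ => abs_mul _ _
    have h2 := Finset.sum_le_sum (s := Finset.univ) fun r _ => h1 r
    rw [Finset.sum_add_distrib, Finset.sum_comm] at h2
    refine h2.trans ?_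
    gcongr
    rw [hT, Finset.mul_sum]
    refine Finset.sum_le_sum fun s _ => ?_
    rw [← Finset.sum_mul]
    exact mul_le_mul_of_nonneg_right (hB s) (abs_nonneg _)
  -- the noise term
  have hnoise : (1 / (n : ℝ)) * (∑ i, (Xa i - Xd.mulVec θ0 i) ^ 2)
      ≤ (1 / (n : ℝ)) * (∑ i, (Xa i - Xd.mulVec θhat i) ^ 2) + (lam0 + B * mu0) * T := by
    have h1 : ∑ i, (Xa i - Xd.mulVec θ0 i) ^ 2 ≤ ∑ i, (Xa i - Xd.mulVec θhat i) ^ 2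
        + 2 * ∑ i, ∑ j, (eps i * Xd i j) * (θhat j - θ0 j) := by
      rw [Finset.mul_sum, ← Finset.sum_add_distrib]
      refine Finset.sum_le_sum fun i _ => ?_
      have e : ∑ j, (eps i * Xd i j) * (θhat j - θ0 j)
          = eps i * (Xd.mulVec θhat i - Xd.mulVec θ0 i) := by
        simp only [Matrix.mulVec, dotProduct, ← Finset.sum_sub_distrib, Finset.mul_sum]
        exact Finset.sum_congr rfl fun s _ => by ring
      have hx : Xa i = Xd.mulVec θ0 i + eps i := by rw [hmodel]; rfl
      rw [e, hx]
      nlinarith [sq_nonneg (Xd.mulVec θhat i - Xd.mulVec θ0 i)]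
    have h2 := mul_le_mul_of_nonneg_left h1 hN
    have h3 : (2 / (n : ℝ)) * ∑ i, ∑ j, (eps i * Xd i j) * (θhat j - θ0 j)
        ≤ (lam0 + B * mu0) * T := by
      rw [Finset.sum_comm, hT, Finset.mul_sum, Finset.mul_sum]
      refine Finset.sum_le_sum fun j _ => ?_
      rw [← Finset.sum_mul]
      refine le_trans ?_ (mul_le_mul_of_nonneg_right (hΛ j) (abs_nonneg _))
      rw [mul_assoc, ← abs_mul]
      exact mul_le_mul_of_nonneg_left (le_abs_self _) (by positivity)
    have h4 : 2 / (n : ℝ) = 1 / n * 2 := by ring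
    rw [h4] at h3
    linarith
  -- splitting along the active set
  have hz : ∀ j ∈ S0ᶜ, θ0 j = 0 := by
    intro j hj
    by_contra h
    exact (Finset.mem_compl.mp hj) ((hS0 j).2 h)
  set a : ℝ := ∑ j ∈ S0ᶜ, |θhat j| with ha
  set d : ℝ := ∑ j ∈ S0, |θhat j - θ0 j| with hd
  have ha0 : 0 ≤ a := Finset.sum_nonneg fun r _ => abs_nonneg _
  have hd0 : 0 ≤ d := Finset.sum_nonneg fun r _ => abs_nonneg _
  have hTad : T = d + a := by
    rw [hT, ← Finset.sum_add_sum_compl S0]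
    congr 1
    exact Finset.sum_congr rfl fun j hj => by rw [hz j hj, sub_zero]
  have hnorm : ∑ j, |θ0 j| + a ≤ ∑ j, |θhat j| + d := by
    rw [← Finset.sum_add_sum_compl S0 (fun j => |θ0 j|),
      ← Finset.sum_add_sum_compl S0 (fun j => |θhat j|)]
    have h1 : ∑ j ∈ S0ᶜ, |θ0 j| = 0 :=
      Finset.sum_eq_zero fun j hj => by rw [hz j hj, abs_zero]
    have h2 : ∑ j ∈ S0, |θ0 j| ≤ ∑ j ∈ S0, |θhat j| + d := by
      rw [hd, ← Finset.sum_add_distrib]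
      refine Finset.sum_le_sum fun j _ => ?_
      have := abs_sub (θhat j) (θhat j - θ0 j)
      rwa [sub_sub_cancel] at this
    linarith
  -- combination
  have k1 := mul_le_mul_of_nonneg_left hDd hmupos.le
  have k2 := mul_le_mul_of_nonneg_left hnorm hlampos.le
  have hBmu0 : B * mu0 ≤ B * mu / 2 := by nlinarith
  have k3 : (lam0 + B * mu0) * T ≤ (lam / 2 + B * mu / 2) * T :=
    mul_le_mul_of_nonneg_right (by linarith) hT0
  set c : ℝ := B * mu with hc
  have hc0 : 0 ≤ c := mul_nonneg hB0 hmupos.le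
  have k1' : mu * ∑ r, |D.mulVec θ0 r| ≤ mu * ∑ r, |D.mulVec θhat r| + c * T := by
    rw [hc]; linarith
  have key : (lam - 3 * c) * a ≤ (3 * lam + 3 * c) * d := by
    have : lam * a ≤ lam * d + (lam / 2 + c / 2) * T + c * T := by linarith
    rw [hTad] at this
    linarith
  have hΔlam : (3 * Δ + 14) * c ≤ Δ * lam := by
    have h := mul_le_mul_of_nonneg_left hlamMu hΔ.le
    have e : Δ * ((3 + 14 / Δ) * c) = (3 * Δ + 14) * c := by field_simp
    linarith
  have hpos : 0 < lam - 3 * c := by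
    rcases hc0.eq_or_lt with h | h
    · rw [← h]; linarith
    · by_contra hneg
      nlinarith
  have hfin : (3 * lam + 3 * c) * d ≤ ((3 + Δ) * (lam - 3 * c)) * d :=
    mul_le_mul_of_nonneg_right (by linarith) hd0
  refine le_of_mul_le_mul_left ?_ hpos
  linarith
end

section
/- Assume the linear model X_a = X^aθ⁰_a + ε_a with S₀ = {j : θ⁰_{a,j} ≠ 0}, s₀ = |S₀|, and assume S₀ satisfies the Δ-compatibility condition with constant φ²_{0,a} > 0 for some Δ > 0. On the event Λ_a = { max_{j≠a} (2/n)|ε_aᵀX^a_j| ≤ λ₀ + Bμ₀ }, if λ ≥ 2λ₀, μ ≥ 2μ₀ and λ ≥ (3 + 14/Δ)Bμ, then the neighborhood-fused lasso estimate θ̂^{λ,μ}_a satisfies the oracle inequality (1/n)‖X^a(θ̂^{λ,μ}_a − θ⁰_a)‖² + (λ − 3Bμ)‖θ̂^{λ,μ}_a − θ⁰_a‖₁ ≤ s₀(2λ + Bμ)²/φ²_{0,a}. -/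
open Finset Matrix

theorem nfl_scalar_aux (lam k Δ P a b t : ℝ) (hΔ : 0 < Δ) (hlamp : 0 < lam) (hk : 0 ≤ k)
    (hlamΔ : (3 * Δ + 14) * k ≤ Δ * lam) (ha : 0 ≤ a) (hP : 0 ≤ P) (ht : 0 ≤ t)
    (hc : b ≤ (3 + Δ) * a → a ^ 2 ≤ t * P)
    (key : 2 * P + (lam - 3 * k) * b ≤ (3 * lam + 3 * k) * a) :
    P + (lam - 3 * k) * (a + b) ≤ t * (2 * lam + k) ^ 2 := by
  have hpos : 0 < lam - 3 * k := by
    have : 0 < Δ * (lam - 3 * k) := by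
      rcases hk.eq_or_lt with h | h
      · rw [← h]; simpa using mul_pos hΔ hlamp
      · nlinarith
    exact pos_of_mul_pos_right this hΔ.le
  have hcone : b ≤ (3 + Δ) * a := by
    have h4 : 3 * lam + 3 * k ≤ (3 + Δ) * (lam - 3 * k) := by nlinarith
    have h5 := mul_le_mul_of_nonneg_right h4 ha
    refine le_of_mul_le_mul_left ?_ hpos
    linarith
  have ha2 := hc hcone
  have hamgm : 4 * lam * a ≤ P + 4 * lam ^ 2 * t := by
    refine abs_le_of_sq_le_sq' ?_ (by positivity) |>.2
    have := mul_le_mul_of_nonneg_left ha2 (sq_nonneg (4 * lam))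
    nlinarith [sq_nonneg (P - 4 * lam ^ 2 * t)]
  have hfin : 4 * lam ^ 2 * t ≤ t * (2 * lam + k) ^ 2 := by
    have : 4 * lam ^ 2 ≤ (2 * lam + k) ^ 2 := by nlinarith
    nlinarith [mul_le_mul_of_nonneg_left this ht]
  linarith

/-- (Oracle inequality under the `Δ`-compatibility condition.)
Assume the linear model `X_a = X^aθ⁰ + ε` with active set `S₀ = {j : θ⁰_j ≠ 0}`,
`s₀ = |S₀|`, and assume the `Δ`-compatibility condition with constant `φ² > 0`.
On the event `Λ_a`, if `λ ≥ 2λ₀`, `μ ≥ 2μ₀` and `λ ≥ (3 + 14/Δ)Bμ`, then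
`(1/n)‖X^a(θ̂−θ⁰)‖² + (λ−3Bμ)‖θ̂−θ⁰‖₁ ≤ s₀(2λ+Bμ)²/φ²`. -/
theorem nfl_oracle_inequality_compatibility
    {n q m : ℕ}
    (Xa : Fin n → ℝ)                         -- response (the `a`-th variable)
    (Xd : Matrix (Fin n) (Fin q) ℝ)          -- design matrix `X^a`
    (θ0 : Fin q → ℝ) (eps : Fin n → ℝ)
    (hmodel : Xa = Xd.mulVec θ0 + eps)       -- linear truth
    (S0 : Finset (Fin q)) (hS0 : ∀ j, j ∈ S0 ↔ θ0 j ≠ 0)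
    (D : Matrix (Fin m) (Fin q) ℝ)
    -- rows of the difference matrix `D^a` have the form `e_i − e_j`
    (hD : ∀ r : Fin m, ∃ i j : Fin q, i ≠ j ∧
      D r = fun s => (if s = i then (1 : ℝ) else 0) - (if s = j then 1 else 0))
    (B : ℝ)
    -- `B` bounds the maximal column `ℓ₁`-norm of `D^a` (number of local neighbors)
    (hB : ∀ b : Fin q, (∑ r, |D r b|) ≤ B)
    (lam0 mu0 lam mu : ℝ) (hlam0 : 0 < lam0) (hmu0 : 0 < mu0)
    (hlam : lam ≥ 2 * lam0) (hmu : mu ≥ 2 * mu0)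
    (Δ : ℝ) (hΔ : 0 < Δ) (hlamMu : lam ≥ (3 + 14 / Δ) * (B * mu))
    (φsq : ℝ) (hφsq : 0 < φsq)
    -- the `Δ`-compatibility condition for `S₀` with restricted eigenvalue `φ²`
    (hcompat : ∀ θ : Fin q → ℝ,
      (∑ j ∈ S0ᶜ, |θ j|) ≤ (3 + Δ) * ∑ j ∈ S0, |θ j| →
      (∑ j ∈ S0, |θ j|) ^ 2 ≤
        (S0.card : ℝ) * (θ ⬝ᵥ (Xdᵀ * Xd).mulVec θ) / ((n : ℝ) * φsq))
    -- the event `Λ_a`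
    (hΛ : ∀ j : Fin q, (2 / (n : ℝ)) * |∑ i, eps i * Xd i j| ≤ lam0 + B * mu0)
    (θhat : Fin q → ℝ)
    (hθhat : ∀ θ : Fin q → ℝ,
      (1 / (n : ℝ)) * (∑ i, (Xa i - Xd.mulVec θhat i) ^ 2)
          + lam * ∑ j, |θhat j| + mu * ∑ r, |D.mulVec θhat r| ≤
      (1 / (n : ℝ)) * (∑ i, (Xa i - Xd.mulVec θ i) ^ 2)
          + lam * ∑ j, |θ j| + mu * ∑ r, |D.mulVec θ r|) :
    (1 / (n : ℝ)) * (∑ i, (Xd.mulVec (θhat - θ0) i) ^ 2)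
        + (lam - 3 * B * mu) * ∑ j, |θhat j - θ0 j| ≤
    (S0.card : ℝ) * (2 * lam + B * mu) ^ 2 / φsq := by
  have hB0 : ∀ b : Fin q, 0 ≤ B := fun b =>
    le_trans (Finset.sum_nonneg fun r _ => abs_nonneg _) (hB b)
  rcases Nat.eq_zero_or_pos q with hq | hq
  · subst hq
    have h1 : S0 = ∅ := Finset.eq_empty_of_isEmpty S0
    have h2 : ∀ i, Xd.mulVec (θhat - θ0) i = 0 := fun i => by
      simp [Matrix.mulVec, dotProduct]
    simp [h1]
  have hBn : 0 ≤ B := hB0 ⟨0, hq⟩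
  have hmup : 0 < mu := by linarith
  have hlamp : 0 < lam := by linarith
  have hk : 0 ≤ B * mu := mul_nonneg hBn hmup.le
  obtain ⟨δ, hδ⟩ : ∃ δ, δ = θhat - θ0 := ⟨_, rfl⟩
  have hθ : θhat = θ0 + δ := by rw [hδ]; abel
  have hδj : ∀ j, θhat j - θ0 j = δ j := fun j => by rw [hδ]; rfl
  rw [← hδ]
  simp only [hδj]
  have hbasic := hθhat θ0
  have e0 : ∀ i, Xa i - Xd.mulVec θ0 i = eps i := fun i => by
    rw [hmodel]; simp
  have e1 : ∀ i, Xa i - Xd.mulVec θhat i = eps i - Xd.mulVec δ i := fun i => by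
    rw [hmodel, hθ, Matrix.mulVec_add]; simp only [Pi.add_apply]; ring
  simp only [e0, e1] at hbasic
  have e2 : ∑ i, (eps i - Xd.mulVec δ i) ^ 2 =
      ∑ i, eps i ^ 2 - 2 * ∑ i, eps i * Xd.mulVec δ i + ∑ i, (Xd.mulVec δ i) ^ 2 := by
    rw [Finset.mul_sum, ← Finset.sum_sub_distrib, ← Finset.sum_add_distrib]
    exact Finset.sum_congr rfl fun i _ => by ring
  rw [e2] at hbasic
  -- the noise term
  have hnoise : (2 / (n : ℝ)) * ∑ i, eps i * Xd.mulVec δ i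
      ≤ (lam0 + B * mu0) * ∑ j, |δ j| := by
    have h1 : ∑ i, eps i * Xd.mulVec δ i = ∑ j, (∑ i, eps i * Xd i j) * δ j := by
      simp only [Matrix.mulVec, dotProduct, Finset.mul_sum, Finset.sum_mul]
      rw [Finset.sum_comm]
      exact Finset.sum_congr rfl fun i _ => Finset.sum_congr rfl fun j _ => by ring
    rw [h1, Finset.mul_sum, Finset.mul_sum]
    refine Finset.sum_le_sum fun j _ => ?_
    have hn : (0 : ℝ) ≤ 2 / (n : ℝ) := by positivity
    calc 2 / (n : ℝ) * ((∑ i, eps i * Xd i j) * δ j)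
        ≤ 2 / (n : ℝ) * (|∑ i, eps i * Xd i j| * |δ j|) := by
          rw [← abs_mul]
          exact mul_le_mul_of_nonneg_left (le_abs_self _) hn
      _ = (2 / (n : ℝ) * |∑ i, eps i * Xd i j|) * |δ j| := by ring
      _ ≤ _ := mul_le_mul_of_nonneg_right (hΛ j) (abs_nonneg _)
  -- the fusion term
  have hDδ : ∑ r, |D.mulVec δ r| ≤ B * ∑ j, |δ j| := by
    calc ∑ r, |D.mulVec δ r| ≤ ∑ r, ∑ j, |D r j| * |δ j| := by
          refine Finset.sum_le_sum fun r _ => ?_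
          simp only [Matrix.mulVec, dotProduct, ← abs_mul]
          exact Finset.abs_sum_le_sum_abs _ _
      _ = ∑ j, (∑ r, |D r j|) * |δ j| := by
          rw [Finset.sum_comm]; simp only [Finset.sum_mul]
      _ ≤ ∑ j, B * |δ j| :=
          Finset.sum_le_sum fun j _ => mul_le_mul_of_nonneg_right (hB j) (abs_nonneg _)
      _ = _ := by rw [Finset.mul_sum]
  have hfuse : ∑ r, |D.mulVec θ0 r| ≤ ∑ r, |D.mulVec θhat r| + ∑ r, |D.mulVec δ r| := by
    rw [← Finset.sum_add_distrib]
    refine Finset.sum_le_sum fun r _ => ?_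
    have : D.mulVec θ0 r = D.mulVec θhat r - D.mulVec δ r := by
      rw [hθ, Matrix.mulVec_add]; simp
    rw [this]; exact abs_sub _ _
  -- split
  have hsplit : ∑ j, |δ j| = ∑ j ∈ S0, |δ j| + ∑ j ∈ S0ᶜ, |δ j| :=
    (Finset.sum_add_sum_compl S0 _).symm
  have hl1 : ∑ j, |θ0 j| + ∑ j ∈ S0ᶜ, |δ j| ≤ ∑ j, |θhat j| + ∑ j ∈ S0, |δ j| := by
    rw [← Finset.sum_add_sum_compl S0 fun j => |θ0 j|,
      ← Finset.sum_add_sum_compl S0 fun j => |θhat j|]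
    have hz : ∀ j ∈ S0ᶜ, θ0 j = 0 := fun j hj => by
      by_contra h
      exact (Finset.mem_compl.mp hj) ((hS0 j).2 h)
    have h1 : ∑ j ∈ S0ᶜ, |θ0 j| = 0 :=
      Finset.sum_eq_zero fun j hj => by rw [hz j hj, abs_zero]
    have h2 : ∑ j ∈ S0ᶜ, |θhat j| = ∑ j ∈ S0ᶜ, |δ j| :=
      Finset.sum_congr rfl fun j hj => by rw [← hδj, hz j hj, sub_zero]
    have h3 : ∑ j ∈ S0, |θ0 j| ≤ ∑ j ∈ S0, |θhat j| + ∑ j ∈ S0, |δ j| := by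
      rw [← Finset.sum_add_distrib]
      refine Finset.sum_le_sum fun j _ => ?_
      have : θ0 j = θhat j - δ j := by linarith [hδj j]
      rw [this]; exact abs_sub _ _
    linarith
  have hQ : δ ⬝ᵥ (Xdᵀ * Xd).mulVec δ = ∑ i, (Xd.mulVec δ i) ^ 2 := by
    rw [← Matrix.mulVec_mulVec, Matrix.dotProduct_mulVec, Matrix.vecMul_transpose]
    simp only [dotProduct, sq]
  have hc := hcompat δ
  rw [hQ] at hc
  have ha : 0 ≤ ∑ j ∈ S0, |δ j| := Finset.sum_nonneg fun _ _ => abs_nonneg _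
  have hb : 0 ≤ ∑ j ∈ S0ᶜ, |δ j| := Finset.sum_nonneg fun _ _ => abs_nonneg _
  have hP : 0 ≤ (1 / (n : ℝ)) * ∑ i, (Xd.mulVec δ i) ^ 2 :=
    mul_nonneg (by positivity) (Finset.sum_nonneg fun _ _ => sq_nonneg _)
  rw [hsplit] at hDδ hnoise ⊢
  have ht : 0 ≤ (S0.card : ℝ) / φsq := div_nonneg (Nat.cast_nonneg _) hφsq.le
  have e3 : (S0.card : ℝ) * (∑ i, (Xd.mulVec δ i) ^ 2) / ((n : ℝ) * φsq) =
      (S0.card : ℝ) / φsq * ((1 / (n : ℝ)) * ∑ i, (Xd.mulVec δ i) ^ 2) := by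
    simp only [div_eq_mul_inv, mul_inv]; ring
  rw [e3] at hc
  have e4 : (S0.card : ℝ) * (2 * lam + B * mu) ^ 2 / φsq =
      (S0.card : ℝ) / φsq * (2 * lam + B * mu) ^ 2 := by ring
  rw [e4]
  have e5 : 2 / (n : ℝ) * ∑ i, eps i * Xd.mulVec δ i =
    1 / (n : ℝ) * (2 * ∑ i, eps i * Xd.mulVec δ i) := by ring
  rw [e5] at hnoise
  rw [mul_add, mul_sub] at hbasic
  generalize (1 / (n : ℝ)) * ∑ i, (Xd.mulVec δ i) ^ 2 = P at *
  generalize ∑ j ∈ S0, |δ j| = a at *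
  generalize ∑ j ∈ S0ᶜ, |δ j| = b at *
  generalize (S0.card : ℝ) / φsq = t at *
  have h3 : 3 * B * mu = 3 * (B * mu) := by ring
  rw [h3]
  have hlamΔ : (3 * Δ + 14) * (B * mu) ≤ Δ * lam := by
    have := mul_le_mul_of_nonneg_left hlamMu hΔ.le
    have e : Δ * ((3 + 14 / Δ) * (B * mu)) = (3 * Δ + 14) * (B * mu) := by
      field_simp
    linarith
  have hn2 : (lam0 + B * mu0) * (a + b) ≤ (lam / 2 + B * mu / 2) * (a + b) := by
    refine mul_le_mul_of_nonneg_right ?_ (by linarith)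
    have := mul_le_mul_of_nonneg_left hmu hBn
    linarith
  have hf2 := mul_le_mul_of_nonneg_left (hfuse.trans (add_le_add_right hDδ _)) hmup.le
  have hl2 := mul_le_mul_of_nonneg_left hl1 hlamp.le
  generalize hkk : B * mu = k at *
  have hf3 : mu * (B * (a + b)) = k * (a + b) := by rw [← hkk]; ring
  have key : 2 * P + (lam - 3 * k) * b ≤ (3 * lam + 3 * k) * a := by
    simp only [mul_add] at hf2 hl2 hf3
    linarith
  exact nfl_scalar_aux lam k Δ P a b t hΔ hlamp hk hlamΔ ha hP ht hc key
end
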